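/- Suppose f₃ : ℝ³ → ℝ is measurable, nonnegative on [0,1]³, symmetric in its first two arguments (f₃(x₁,x₂,x₃) = f₃(x₂,x₁,x₃) for all x₁,x₂,x₃ ∈ [0,1]), vanishes where f₂ vanishes (for all x₁,x₂ ∈ [0,1], f₂(x₁,x₂) = 0 implies f₃(x₁,x₂,x₃) = 0 for all x₃ ∈ [0,1]), and satisfies the consistency requirement f₂(x₁,x₂) = ∫₀¹ f₃(x₁,x₃,x₂) dx₃ for all x₁,x₂ ∈ [0,1]. Then f₃(x₁,x₃,1/8) = 0 for almost every (x₁,x₃) ∈ [0,1]², and consequently ∫₀¹ f₂(x₁, 1/8) dx₁ = 0. -/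

import Mathlib

open MeasureTheory

/-- The domain Ω from the paper: a diamond with a square hole removed. -/
def Omega : Set (ℝ × ℝ) :=
  {p : ℝ × ℝ | |p.1 - 1/2| + |p.2 - 1/2| < 1/2} \
    {p : ℝ × ℝ | |p.1 - 1/2| < 1/4 ∧ |p.2 - 1/2| < 1/4}

/-- The two-particle distribution `f₂ = 4 χ_Ω`. -/
noncomputable def f₂ (x₁ x₂ : ℝ) : ℝ :=
  4 * Omega.indicator (fun _ => (1 : ℝ)) (x₁, x₂)

/-- Splitting `[0,1]` into the open middle half and the rest. -/
lemma split_unit (h : ℝ → ENNReal) :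
    ∫⁻ y in Set.Icc (0:ℝ) 1, h y =
      (∫⁻ y in Set.Ioo (1/4:ℝ) (3/4), h y) +
        ∫⁻ y in Set.Icc (0:ℝ) 1 \ Set.Ioo (1/4:ℝ) (3/4), h y := by
  have hs : Set.Icc (0:ℝ) 1 ∩ Set.Ioo (1/4:ℝ) (3/4) = Set.Ioo (1/4:ℝ) (3/4) := by
    ext x
    simp only [Set.mem_inter_iff, Set.mem_Icc, Set.mem_Ioo]
    constructor
    · exact fun h => h.2
    · intro h
      refine ⟨⟨?_, ?_⟩, h⟩ <;> linarith [h.1, h.2]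
  have := lintegral_inter_add_sdiff (μ := volume) h (Set.Icc (0:ℝ) 1)
    (measurableSet_Ioo (a := (1/4:ℝ)) (b := 3/4))
  rw [hs] at this
  exact this.symm

lemma f₂_middle {x : ℝ} (hx : x ∈ Set.Ioo (1/4:ℝ) (3/4)) : f₂ x (1/4) = 4 := by
  have : (x, (1/4:ℝ)) ∈ Omega := by
    refine ⟨?_, ?_⟩
    · have h1 : |x - 1/2| < 1/4 := by
        rw [abs_lt]; constructor <;> linarith [hx.1, hx.2]
      have h2 : |(1/4:ℝ) - 1/2| = 1/4 := by norm_num [abs_of_neg]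
      simp only [Set.mem_ofPred_eq, h2]
      linarith
    · rintro ⟨-, h⟩
      have h2 : |(1/4:ℝ) - 1/2| = 1/4 := by norm_num [abs_of_neg]
      simp only [h2] at h
      exact lt_irrefl _ h
  rw [f₂, Set.indicator_of_mem this, mul_one]

lemma outer_abs {x : ℝ} (hx : x ∉ Set.Ioo (1/4:ℝ) (3/4)) : 1/4 ≤ |x - 1/2| := by
  by_contra h
  push Not at h
  rw [abs_lt] at h
  exact hx ⟨by linarith [h.1], by linarith [h.2]⟩

lemma f₂_middle_middle {x y : ℝ} (hx : x ∈ Set.Ioo (1/4:ℝ) (3/4))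
    (hy : y ∈ Set.Ioo (1/4:ℝ) (3/4)) : f₂ x y = 0 := by
  have : (x, y) ∉ Omega := by
    rintro ⟨-, h⟩
    apply h
    constructor
    · simp only [abs_lt]; constructor <;> linarith [hx.1, hx.2]
    · simp only [abs_lt]; constructor <;> linarith [hy.1, hy.2]
  simp [f₂, Set.indicator_of_notMem this]

lemma f₂_outer_outer {x y : ℝ} (hx : x ∉ Set.Ioo (1/4:ℝ) (3/4))
    (hy : y ∉ Set.Ioo (1/4:ℝ) (3/4)) : f₂ x y = 0 := by
  have : (x, y) ∉ Omega := by
    rintro ⟨h, -⟩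
    simp only [Set.mem_ofPred_eq] at h
    linarith [outer_abs hx, outer_abs hy]
  simp [f₂, Set.indicator_of_notMem this]

/-- Under the symmetry, nonnegativity, vanishing and consistency requirements,
`f₃(x₁,x₃,1/8) = 0` for a.e. `(x₁,x₃) ∈ [0,1]²`, and hence
`∫₀¹ f₂(x₁,1/8) dx₁ = 0`. -/
theorem f₃_vanishes_at_eighth (f₃ : ℝ × ℝ × ℝ → ℝ)
    (hmeas : Measurable f₃)
    (hnonneg : ∀ x₁ ∈ Set.Icc (0:ℝ) 1, ∀ x₂ ∈ Set.Icc (0:ℝ) 1, ∀ x₃ ∈ Set.Icc (0:ℝ) 1,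
      0 ≤ f₃ (x₁, x₂, x₃))
    (hsymm : ∀ x₁ ∈ Set.Icc (0:ℝ) 1, ∀ x₂ ∈ Set.Icc (0:ℝ) 1, ∀ x₃ ∈ Set.Icc (0:ℝ) 1,
      f₃ (x₁, x₂, x₃) = f₃ (x₂, x₁, x₃))
    (hvanish : ∀ x₁ ∈ Set.Icc (0:ℝ) 1, ∀ x₂ ∈ Set.Icc (0:ℝ) 1, f₂ x₁ x₂ = 0 →
      ∀ x₃ ∈ Set.Icc (0:ℝ) 1, f₃ (x₁, x₂, x₃) = 0)
    (hconsist : ∀ x₁ ∈ Set.Icc (0:ℝ) 1, ∀ x₂ ∈ Set.Icc (0:ℝ) 1,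
      f₂ x₁ x₂ = ∫ x₃ in Set.Icc (0:ℝ) 1, f₃ (x₁, x₃, x₂)) :
    (∀ᵐ p ∂(volume.restrict (Set.Icc (0:ℝ) 1 ×ˢ Set.Icc (0:ℝ) 1)),
      f₃ (p.1, p.2, 1/8) = 0) ∧
    (∫ x₁ in Set.Icc (0:ℝ) 1, f₂ x₁ (1/8)) = 0 := by
  -- The requirements are already contradictory on the slice `x₃ = 1/4`.
  exfalso
  have hq : (1/4:ℝ) ∈ Set.Icc (0:ℝ) 1 := by constructor <;> norm_num
  have hAI : ∀ x ∈ Set.Ioo (1/4:ℝ) (3/4), x ∈ Set.Icc (0:ℝ) 1 := by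
    intro x hx
    constructor <;> linarith [hx.1, hx.2]
  have hBm : MeasurableSet (Set.Icc (0:ℝ) 1 \ Set.Ioo (1/4:ℝ) (3/4)) :=
    measurableSet_Icc.diff measurableSet_Ioo
  have hrow : ∀ x, Measurable fun y => f₃ (x, y, 1/4) := fun x => by fun_prop
  have hnn : ∀ x ∈ Set.Icc (0:ℝ) 1,
      0 ≤ᵐ[volume.restrict (Set.Icc (0:ℝ) 1)] fun y => f₃ (x, y, 1/4) := by
    intro x hx
    filter_upwards [ae_restrict_mem measurableSet_Icc] with y hy
    exact hnonneg x hx y hy _ hq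
  have h1 : ∀ x ∈ Set.Ioo (1/4:ℝ) (3/4),
      ∫⁻ y in Set.Icc (0:ℝ) 1 \ Set.Ioo (1/4:ℝ) (3/4),
        ENNReal.ofReal (f₃ (x, y, 1/4)) = 4 := by
    intro x hx
    have hc := hconsist x (hAI x hx) _ hq
    rw [f₂_middle hx] at hc
    have hint : Integrable (fun y => f₃ (x, y, 1/4)) (volume.restrict (Set.Icc (0:ℝ) 1)) := by
      by_contra hni
      rw [integral_undef hni] at hc
      norm_num at hc
    have h := ofReal_integral_eq_lintegral_ofReal hint (hnn x (hAI x hx))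
    rw [← hc, split_unit, setLIntegral_congr_fun (g := fun _ => 0) measurableSet_Ioo] at h
    · simpa using h.symm
    · intro y hy
      simp only [hvanish x (hAI x hx) y (hAI y hy) (f₂_middle_middle hx hy) _ hq, ENNReal.ofReal_zero]
  have h2 : ∫⁻ x in Set.Ioo (1/4:ℝ) (3/4),
      ∫⁻ y in Set.Icc (0:ℝ) 1 \ Set.Ioo (1/4:ℝ) (3/4),
        ENNReal.ofReal (f₃ (x, y, 1/4)) = 4 * ENNReal.ofReal (3/4 - 1/4) := by
    rw [setLIntegral_congr_fun (g := fun _ => 4) measurableSet_Ioo h1]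
    simp
  have hG : Measurable (fun p : ℝ × ℝ => ENNReal.ofReal (f₃ (p.1, p.2, 1/4))) := by fun_prop
  rw [lintegral_lintegral_swap hG.aemeasurable] at h2
  have hfin : ∀ᵐ y ∂(volume.restrict (Set.Icc (0:ℝ) 1 \ Set.Ioo (1/4:ℝ) (3/4))),
      ∫⁻ x in Set.Ioo (1/4:ℝ) (3/4), ENNReal.ofReal (f₃ (x, y, 1/4)) < ⊤ := by
    apply ae_lt_top
    · exact Measurable.lintegral_prod_left' hG
    · rw [h2]
      exact ENNReal.mul_ne_top (by simp) (by simp)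
  have hz : ∀ᵐ y ∂(volume.restrict (Set.Icc (0:ℝ) 1 \ Set.Ioo (1/4:ℝ) (3/4))),
      ∫⁻ x in Set.Ioo (1/4:ℝ) (3/4), ENNReal.ofReal (f₃ (x, y, 1/4)) = 0 := by
    filter_upwards [hfin, ae_restrict_mem hBm] with y hy hyB
    have he : ∫⁻ x in Set.Icc (0:ℝ) 1, ENNReal.ofReal (f₃ (y, x, 1/4)) =
        ∫⁻ x in Set.Ioo (1/4:ℝ) (3/4), ENNReal.ofReal (f₃ (x, y, 1/4)) := by
      rw [split_unit, setLIntegral_congr_fun (s := Set.Icc (0:ℝ) 1 \ _) (g := fun _ => 0) hBm,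
        setLIntegral_congr_fun (s := Set.Ioo (1/4:ℝ) (3/4))
          (g := fun x => ENNReal.ofReal (f₃ (x, y, 1/4))) measurableSet_Ioo]
      · simp
      · intro x hx
        simp only [hsymm y hyB.1 x (hAI x hx) _ hq]
      · intro x hx
        simp only [hvanish y hyB.1 x hx.1 (f₂_outer_outer hyB.2 hx.2) _ hq, ENNReal.ofReal_zero]
    have hint : Integrable (fun x => f₃ (y, x, 1/4)) (volume.restrict (Set.Icc (0:ℝ) 1)) := by
      refine ⟨(hrow y).aestronglyMeasurable, ?_⟩
      rw [hasFiniteIntegral_iff_ofReal (hnn y hyB.1), he]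
      exact hy
    have h := ofReal_integral_eq_lintegral_ofReal hint (hnn y hyB.1)
    rw [← hconsist y hyB.1 _ hq, f₂_outer_outer (y := 1/4) hyB.2 (by simp), he] at h
    simpa using h.symm
  rw [lintegral_congr_ae hz] at h2
  norm_num at h2
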